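/- The weighted degrees satisfy ∑_{Q∈S} (e_Q − 1)·wdeg(Q) = ∑_{i=1}^{n} aᵢ − ∑_{i=1}^{n} bᵢ, where wdeg denotes the weighted degree with respect to the weights b₁,…,bₙ and the sum on the left runs over representatives of the ramified irreducibles of B. -/

import Mathlib

noncomputable section

open MvPolynomial

/-- The multiplicity of `Q` in the factorization of `P` equals `e`. -/
def MultIs {σ : Type} (Q P : MvPolynomial σ ℂ) (e : ℕ) : Prop :=
  Q ^ e ∣ P ∧ ¬ Q ^ (e + 1) ∣ P

/-- The Jacobian `det (∂ f i / ∂ X j)` of an `n`-tuple of polynomials. -/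
def Jac {n : ℕ} (f : Fin n → MvPolynomial (Fin n) ℂ) : MvPolynomial (Fin n) ℂ :=
  (Matrix.of fun i j : Fin n => pderiv j (f i)).det

/-- `RamIdx A Q e` : the contraction `QB ∩ A` is generated by an irreducible `P ∈ A`,
and `e` is the multiplicity of `Q` in the factorization of `P` in `B`. -/
def RamIdx {σ : Type} (A : Subalgebra ℂ (MvPolynomial σ ℂ))
    (Q : MvPolynomial σ ℂ) (e : ℕ) : Prop :=
  ∃ P : A, Irreducible P ∧
    (Ideal.span {Q}).comap (algebraMap A (MvPolynomial σ ℂ)) = Ideal.span {P} ∧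
    MultIs Q (P : MvPolynomial σ ℂ) e

/-- `Q` is a ramified irreducible of `B` over `A`. -/
def IsRamified {σ : Type} (A : Subalgebra ℂ (MvPolynomial σ ℂ))
    (Q : MvPolynomial σ ℂ) : Prop :=
  Irreducible Q ∧ ∃ e, RamIdx A Q e ∧ 1 < e

/-- `RamReps A S e` : `S` is a finite set of pairwise non-associated irreducible elements of `B`,
each ramified with ramification index `e Q`, and every ramified irreducible of `B` is associated
to exactly one element of `S`. -/
def RamReps {σ : Type} (A : Subalgebra ℂ (MvPolynomial σ ℂ))
    (S : Finset (MvPolynomial σ ℂ)) (e : MvPolynomial σ ℂ → ℕ) : Prop :=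
  (∀ Q ∈ S, Irreducible Q ∧ RamIdx A Q (e Q) ∧ 1 < e Q) ∧
  (∀ Q ∈ S, ∀ Q' ∈ S, Q ≠ Q' → ¬ Associated Q Q') ∧
  (∀ Q : MvPolynomial σ ℂ, IsRamified A Q → ∃! Q', Q' ∈ S ∧ Associated Q Q')

/-- The polynomial map `ℂⁿ → ℂⁿ` associated to an `n`-tuple of polynomials. -/
def polyMap {n : ℕ} (f : Fin n → MvPolynomial (Fin n) ℂ) : (Fin n → ℂ) → (Fin n → ℂ) :=
  fun x i => eval x (f i)

/-- The branch locus: points whose fiber has fewer than `r` elements. -/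
def branchLocus {n : ℕ} (f : Fin n → MvPolynomial (Fin n) ℂ) (r : ℕ) : Set (Fin n → ℂ) :=
  {u | (polyMap f ⁻¹' {u}).Finite ∧ (polyMap f ⁻¹' {u}).ncard < r}

end

section WeightedDegree

open MvPolynomial

variable {σ : Type} (b : σ → ℕ)

/-- Substituting `X i ↦ X i * t ^ b i` records the weighted degree as a degree in `t`. -/
noncomputable def weightHom : MvPolynomial σ ℂ →ₐ[ℂ] Polynomial (MvPolynomial σ ℂ) :=
  aeval fun i => Polynomial.C (X i) * Polynomial.X ^ b i

theorem weightHom_monomial (d : σ →₀ ℕ) (c : ℂ) :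
    weightHom b (monomial d c) =
      Polynomial.monomial (Finsupp.weight b d) (monomial d c) := by
  rw [weightHom, aeval_monomial, Finsupp.weight_apply, Finsupp.sum, Finsupp.prod]
  simp_rw [mul_pow, Finset.prod_mul_distrib, ← pow_mul, Finset.prod_pow_eq_pow_sum,
    ← Polynomial.C_mul_X_pow_eq_monomial, smul_eq_mul]
  rw [monomial_eq, Finsupp.prod, ← mul_assoc]
  simp only [map_mul, map_prod, map_pow]
  congr 2
  exact Finset.sum_congr rfl fun i _ => mul_comm _ _

theorem coeff_weightHom (p : MvPolynomial σ ℂ) (m : ℕ) :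
    (weightHom b p).coeff m = weightedHomogeneousComponent b m p := by
  induction p using MvPolynomial.induction_on' with
  | monomial d c =>
    rw [weightHom_monomial, Polynomial.coeff_monomial]
    classical
    rw [weightedHomogeneousComponent_of_mem (n := Finsupp.weight b d)
      (isWeightedHomogeneous_monomial b d c rfl)]
    simp only [eq_comm]
  | add p q hp hq => rw [map_add, Polynomial.coeff_add, hp, hq, map_add]

theorem natDegree_weightHom (p : MvPolynomial σ ℂ) :
    (weightHom b p).natDegree = weightedTotalDegree b p := by
  apply le_antisymm
  · rw [Polynomial.natDegree_le_iff_coeff_eq_zero]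
    intro m hm
    rw [coeff_weightHom]
    exact weightedHomogeneousComponent_eq_zero _ _ hm
  · refine Finset.sup_le fun d hd => Polynomial.le_natDegree_of_ne_zero ?_
    rw [coeff_weightHom]
    intro h
    have h1 := congrArg (coeff d) h
    classical
    rw [coeff_weightedHomogeneousComponent, if_pos rfl, coeff_zero] at h1
    exact mem_support_iff.mp hd h1

theorem weightHom_ne_zero {p : MvPolynomial σ ℂ} (hp : p ≠ 0) : weightHom b p ≠ 0 := by
  obtain ⟨d, hd⟩ := ne_zero_iff.mp hp
  intro h
  have h1 := coeff_weightHom b p (Finsupp.weight b d)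
  rw [h, Polynomial.coeff_zero] at h1
  have h2 := congrArg (coeff d) h1
  classical
  rw [coeff_weightedHomogeneousComponent, if_pos rfl, coeff_zero] at h2
  exact hd h2.symm

theorem weightedTotalDegree_mul {p q : MvPolynomial σ ℂ} (hp : p ≠ 0) (hq : q ≠ 0) :
    weightedTotalDegree b (p * q) = weightedTotalDegree b p + weightedTotalDegree b q := by
  simp only [← natDegree_weightHom, map_mul]
  exact Polynomial.natDegree_mul (weightHom_ne_zero b hp) (weightHom_ne_zero b hq)

theorem weightedTotalDegree_prod_pow {ι : Type*} (s : Finset ι) (p : ι → MvPolynomial σ ℂ)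
    (k : ι → ℕ) (hp : ∀ i ∈ s, p i ≠ 0) :
    weightedTotalDegree b (∏ i ∈ s, p i ^ k i) = ∑ i ∈ s, k i * weightedTotalDegree b (p i) := by
  simp only [← natDegree_weightHom, map_prod, map_pow]
  rw [Polynomial.natDegree_prod _ _ fun i hi => pow_ne_zero _ (weightHom_ne_zero b (hp i hi))]
  simp only [Polynomial.natDegree_pow]

theorem weightedTotalDegree_of_isUnit {p : MvPolynomial σ ℂ} (hp : IsUnit p) :
    weightedTotalDegree b p = 0 := by
  rw [← natDegree_weightHom]
  exact Polynomial.natDegree_eq_zero_of_isUnit (hp.map (weightHom b))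

theorem isWeightedHomogeneous_X_mul_pderiv {p : MvPolynomial σ ℂ} {m : ℕ}
    (hp : IsWeightedHomogeneous b p m) (i : σ) :
    IsWeightedHomogeneous b (X i * pderiv i p) m := by
  rw [← support_sum_monomial_coeff p, map_sum, Finset.mul_sum]
  refine IsWeightedHomogeneous.sum _ _ _ fun d hd => ?_
  rw [X_mul_pderiv_monomial]
  exact (weightedHomogeneousSubmodule ℂ b m).smul_of_tower_mem _
    (isWeightedHomogeneous_monomial b d _ (hp (mem_support_iff.mp hd)))

theorem weightedTotalDegree_jac {n : ℕ} (b a : Fin n → ℕ) (f : Fin n → MvPolynomial (Fin n) ℂ)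
    (hhom : ∀ i, IsWeightedHomogeneous b (f i) (a i)) (hJ : Jac f ≠ 0) :
    ∑ i, b i + weightedTotalDegree b (Jac f) = ∑ i, a i := by
  have hX : (∏ i : Fin n, (X i : MvPolynomial (Fin n) ℂ)) ≠ 0 :=
    Finset.prod_ne_zero_iff.mpr fun i _ => X_ne_zero i
  have hdet : (∏ i, X i) * Jac f =
      (Matrix.of fun i j : Fin n => X j * pderiv j (f i)).det := by
    rw [Jac, ← Matrix.det_mul_row]
    rfl
  have hh : IsWeightedHomogeneous b ((∏ i, X i) * Jac f) (∑ i, a i) := by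
    rw [hdet, Matrix.det_apply]
    refine IsWeightedHomogeneous.sum _ _ _ fun τ _ => ?_
    refine (weightedHomogeneousSubmodule ℂ b (∑ i, a i)).smul_of_tower_mem _ ?_
    rw [← Equiv.sum_comp τ a]
    exact IsWeightedHomogeneous.prod _ _ _ fun i _ =>
      isWeightedHomogeneous_X_mul_pderiv b (hhom _) _
  have hw := hh.weighted_total_degree (mul_ne_zero hX hJ)
  rw [weightedTotalDegree_coe _ _ (mul_ne_zero hX hJ), weightedTotalDegree_mul b hX hJ] at hw
  have hb : weightedTotalDegree b (∏ i : Fin n, (X i : MvPolynomial (Fin n) ℂ)) = ∑ i, b i := by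
    have h1 : IsWeightedHomogeneous b (∏ i : Fin n, (X i : MvPolynomial (Fin n) ℂ)) (∑ i, b i) :=
      IsWeightedHomogeneous.prod _ _ _ fun i _ => isWeightedHomogeneous_X ℂ b i
    have h2 := h1.weighted_total_degree hX
    rw [weightedTotalDegree_coe _ _ hX] at h2
    exact_mod_cast h2
  rw [hb] at hw
  exact_mod_cast hw

end WeightedDegree

section Derivations

open MvPolynomial

/-- A derivation killing the base and the kernel of `B → C` kills everything integral over the
base, when `C` is a domain of characteristic zero. -/
theorem Derivation.eq_zero_of_aeval_mem_ker {R B C : Type*} [CommRing R] [CommRing B] [CommRing C]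
    [IsDomain C] [CharZero C] [Algebra R B] [Algebra R C] [Algebra B C] [IsScalarTower R B C]
    (D : Derivation R B C) (hD : ∀ y, algebraMap B C y = 0 → D y = 0) (x : B) (d : ℕ) :
    ∀ p : Polynomial R, p.natDegree ≤ d → algebraMap R C (p.coeff d) ≠ 0 →
      algebraMap B C (Polynomial.aeval x p) = 0 → D x = 0 := by
  induction d with
  | zero =>
    intro p hp hc hx
    rw [Polynomial.eq_C_of_natDegree_le_zero hp, Polynomial.aeval_C,
      ← IsScalarTower.algebraMap_apply] at hx
    exact absurd hx hc
  | succ d ih =>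
    intro p hp hc hx
    have h := hD _ hx
    rw [Derivation.map_aeval, Algebra.smul_def, mul_eq_zero] at h
    refine h.elim (ih _ ?_ ?_) id
    · exact (Polynomial.natDegree_derivative_le p).trans (by omega)
    · rw [Polynomial.coeff_derivative, map_mul]
      refine mul_ne_zero hc ?_
      have : ((d + 1 : ℕ) : C) ≠ 0 := Nat.cast_ne_zero.mpr d.succ_ne_zero
      simpa using this

theorem Derivation.eq_zero_of_isIntegral {B C : Type*} [CommRing B] [CommRing C]
    [IsDomain C] [Algebra ℂ B] [Algebra ℂ C] [Algebra B C] [IsScalarTower ℂ B C]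
    (A : Subalgebra ℂ B) [Algebra.IsIntegral A B]
    (D : Derivation ℂ B C) (hA : ∀ y ∈ A, D y = 0) (hD : ∀ y, algebraMap B C y = 0 → D y = 0)
    (x : B) : D x = 0 := by
  have : CharZero C := charZero_of_injective_algebraMap (algebraMap ℂ C).injective
  let D' : Derivation A B C :=
    { toFun := D
      map_add' := D.map_add
      map_smul' := fun r y => by
        rw [Subalgebra.smul_def, smul_eq_mul, D.leibniz, hA _ r.2, smul_zero, add_zero]
        rfl
      map_one_eq_zero' := D.map_one_eq_zero
      leibniz' := D.leibniz }
  obtain ⟨p, hp, hx⟩ := Algebra.IsIntegral.isIntegral (R := A) x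
  refine D'.eq_zero_of_aeval_mem_ker hD x p.natDegree p le_rfl ?_ ?_
  · simp [hp.coeff_natDegree]
  · rw [Polynomial.aeval_def, hx, map_zero]

theorem Derivation.mvPolynomial_aeval {σ B M : Type*} [Fintype σ] [CommRing B] [Algebra ℂ B]
    [AddCommGroup M] [Module ℂ M] [Module B M] [IsScalarTower ℂ B M] (D : Derivation ℂ B M)
    (f : σ → B) (p : MvPolynomial σ ℂ) :
    D (aeval f p) = ∑ i, aeval f (pderiv i p) • D (f i) := by
  classical
  induction p using MvPolynomial.induction_on with
  | C c => simp [← algebraMap_eq]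
  | add p q hp hq => simp [hp, hq, add_smul, Finset.sum_add_distrib]
  | mul_X p j hp =>
    simp only [map_mul, aeval_X, D.leibniz, hp, Derivation.leibniz, pderiv_X, map_add,
      smul_eq_mul, add_smul, Finset.sum_add_distrib, Finset.smul_sum, mul_smul]
    congr 1
    rw [Finset.sum_eq_single j]
    · simp
    · intro i _ hi
      simp [Pi.single_eq_of_ne hi.symm]
    · simp

theorem totalDegree_pderiv_lt {σ : Type*} {p : MvPolynomial σ ℂ} {i : σ} (h : pderiv i p ≠ 0) :
    (pderiv i p).totalDegree < p.totalDegree := by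
  classical
  rw [totalDegree, Finset.sup_lt_iff]
  · intro m hm
    rw [mem_support_iff, coeff_pderiv] at hm
    have h1 : m + Finsupp.single i 1 ∈ p.support :=
      mem_support_iff.mpr (left_ne_zero_of_mul hm)
    have h2 := le_totalDegree h1
    rw [Finsupp.sum_add_index' (by simp) (by simp)] at h2
    simp at h2
    omega
  · rw [bot_eq_zero, pos_iff_ne_zero]
    intro h0
    rw [totalDegree_eq_zero_iff_eq_C.mp h0] at h
    exact h pderiv_C

theorem not_dvd_pderiv {σ : Type*} {p : MvPolynomial σ ℂ} {i : σ} (h : pderiv i p ≠ 0) :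
    ¬ p ∣ pderiv i p := by
  rintro ⟨q, hq⟩
  have h1 := totalDegree_pderiv_lt h
  rw [hq] at h h1
  rw [totalDegree_mul_of_isDomain (left_ne_zero_of_mul h) (right_ne_zero_of_mul h)] at h1
  omega

theorem exists_pderiv_ne_zero {σ : Type*} {p : MvPolynomial σ ℂ} (h : p ≠ C (coeff 0 p)) :
    ∃ i, pderiv i p ≠ 0 := by
  classical
  by_contra! hall
  refine h (MvPolynomial.ext _ _ fun m => ?_)
  rw [coeff_C]
  split_ifs with hm
  · rw [hm]
  · obtain ⟨i, hi⟩ : ∃ i, m i ≠ 0 := by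
      by_contra! h0
      exact hm (Finsupp.ext h0).symm
    have h1 := congrArg (coeff (m - Finsupp.single i 1)) (hall i)
    rw [coeff_pderiv, coeff_zero, tsub_add_cancel_of_le
      (Finsupp.single_le_iff.mpr (Nat.one_le_iff_ne_zero.mpr hi))] at h1
    exact (mul_eq_zero.mp h1).resolve_right (Nat.cast_add_one_ne_zero _)

end Derivations

section Ramification

open MvPolynomial

variable {n : ℕ}

/-- The Jacobian matrix of an `n`-tuple of polynomials. -/
noncomputable def jacMatrix (g : Fin n → MvPolynomial (Fin n) ℂ) :
    Matrix (Fin n) (Fin n) (MvPolynomial (Fin n) ℂ) :=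
  Matrix.of fun i j => pderiv j (g i)

theorem jacMatrix_update (f : Fin n → MvPolynomial (Fin n) ℂ) (i : Fin n)
    (g : MvPolynomial (Fin n) ℂ) :
    jacMatrix (Function.update f i g) = (jacMatrix f).updateRow i fun k => pderiv k g := by
  ext k j : 2
  rw [Matrix.updateRow_apply]
  split_ifs with h
  · subst h; simp [jacMatrix]
  · simp [jacMatrix, h]

theorem jac_update_add (f : Fin n → MvPolynomial (Fin n) ℂ) (i : Fin n)
    (g h : MvPolynomial (Fin n) ℂ) :
    Jac (Function.update f i (g + h)) =
      Jac (Function.update f i g) + Jac (Function.update f i h) := by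
  change (jacMatrix _).det = (jacMatrix _).det + (jacMatrix _).det
  simp only [jacMatrix_update]
  rw [← Matrix.det_updateRow_add]
  congr 2
  ext k : 1
  simp

theorem jac_update_mul (f : Fin n → MvPolynomial (Fin n) ℂ) (i : Fin n)
    (g h : MvPolynomial (Fin n) ℂ) :
    Jac (Function.update f i (g * h)) =
      g * Jac (Function.update f i h) + h * Jac (Function.update f i g) := by
  change (jacMatrix _).det = _ * (jacMatrix _).det + _ * (jacMatrix _).det
  simp only [jacMatrix_update]
  rw [← Matrix.det_updateRow_smul, ← Matrix.det_updateRow_smul, ← Matrix.det_updateRow_add]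
  congr 2
  ext k : 1
  simp [Derivation.leibniz]

theorem jac_update_pow (f : Fin n → MvPolynomial (Fin n) ℂ) (i : Fin n)
    (g : MvPolynomial (Fin n) ℂ) (k : ℕ) :
    Jac (Function.update f i (g ^ k)) = k * g ^ (k - 1) * Jac (Function.update f i g) := by
  change (jacMatrix _).det = _ * (jacMatrix _).det
  simp only [jacMatrix_update]
  rw [← Matrix.det_updateRow_smul]
  congr 2
  ext k : 1
  simp [Derivation.leibniz_pow, mul_assoc]

theorem jac_update_aeval (f : Fin n → MvPolynomial (Fin n) ℂ) (i : Fin n)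
    (p : MvPolynomial (Fin n) ℂ) :
    Jac (Function.update f i (aeval f p)) = aeval f (pderiv i p) * Jac f := by
  change (jacMatrix _).det = _ * (jacMatrix _).det
  rw [jacMatrix_update, ← smul_eq_mul,
    ← Matrix.det_updateRow_sum (jacMatrix f) i fun k => aeval f (pderiv k p)]
  congr 2
  ext k : 1
  rw [Derivation.mvPolynomial_aeval, Finset.sum_apply]
  rfl

theorem algebraicIndependent_of_finite_adjoin (f : Fin n → MvPolynomial (Fin n) ℂ)
    [Module.Finite (Algebra.adjoin ℂ (Set.range f)) (MvPolynomial (Fin n) ℂ)] :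
    AlgebraicIndependent ℂ f := by
  have := Algebra.IsAlgebraic.isTranscendenceBasis_of_le_trdeg_of_finite ℂ f
    (by rw [MvPolynomial.trdeg_of_isDomain]; simp)
  exact this.1

/-- Replacing a component by `Q` yields a Jacobian prime to `Q`; here `C` plays the role of the
quotient by `Q`. -/
theorem algebraMap_jac_update_ne_zero {C : Type*} [CommRing C] [IsDomain C] [Algebra ℂ C]
    [Algebra (MvPolynomial (Fin n) ℂ) C] [IsScalarTower ℂ (MvPolynomial (Fin n) ℂ) C]
    (f : Fin n → MvPolynomial (Fin n) ℂ)
    [Algebra.IsIntegral (Algebra.adjoin ℂ (Set.range f)) (MvPolynomial (Fin n) ℂ)]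
    {Q p : MvPolynomial (Fin n) ℂ}
    (hC : ∀ y, algebraMap (MvPolynomial (Fin n) ℂ) C y = 0 ↔ Q ∣ y) (i : Fin n)
    (hp : Q ∣ aeval f p) (hi : ¬ Q ∣ aeval f (pderiv i p)) :
    algebraMap (MvPolynomial (Fin n) ℂ) C (Jac (Function.update f i Q)) ≠ 0 := by
  intro hdvd
  have hdet : ((algebraMap (MvPolynomial (Fin n) ℂ) C).mapMatrix
      (jacMatrix (Function.update f i Q))).det = 0 := by
    rw [← RingHom.map_det]; exact hdvd
  obtain ⟨v, hv0, hv⟩ := Matrix.exists_mulVec_eq_zero_iff.mpr hdet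
  let D : Derivation ℂ (MvPolynomial (Fin n) ℂ) C := mkDerivation ℂ v
  have hD : ∀ g, D g = ∑ k, algebraMap (MvPolynomial (Fin n) ℂ) C (pderiv k g) * v k := fun g => by
    have h := D.mvPolynomial_aeval X g
    rw [aeval_X_left, AlgHom.id_apply] at h
    rw [h]
    refine Finset.sum_congr rfl fun k _ => ?_
    rw [AlgHom.id_apply, Algebra.smul_def, mkDerivation_X]
  have hrow : ∀ k, D (Function.update f i Q k) = 0 := fun k => by
    rw [hD]; exact congrFun hv k
  have hDQ : D Q = 0 := by simpa using hrow i
  have hDker : ∀ y, algebraMap (MvPolynomial (Fin n) ℂ) C y = 0 → D y = 0 := fun y hy => by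
    obtain ⟨z, rfl⟩ := (hC y).mp hy
    rw [D.leibniz, hDQ, smul_zero, add_zero, Algebra.smul_def]
    exact mul_eq_zero_of_left ((hC Q).mpr dvd_rfl) _
  have hDf' : ∀ k, k ≠ i → D (f k) = 0 := fun k hk => by simpa [hk] using hrow k
  have hDfi : D (f i) = 0 := by
    have h := D.mvPolynomial_aeval f p
    rw [hDker _ ((hC _).mpr hp), Finset.sum_eq_single i
      (fun k _ hk => by rw [hDf' k hk, smul_zero]) (by simp), Algebra.smul_def] at h
    exact (mul_eq_zero.mp h.symm).resolve_left fun h0 => hi ((hC _).mp h0)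
  have hDA : ∀ y ∈ Algebra.adjoin ℂ (Set.range f), D y = 0 := by
    intro y hy
    refine Derivation.eqOn_adjoin (D1 := D) (D2 := 0) ?_ hy
    rintro _ ⟨k, rfl⟩
    by_cases hk : k = i
    · rw [hk]; exact hDfi
    · exact hDf' k hk
  refine hv0 (funext fun k => ?_)
  have h := D.eq_zero_of_isIntegral (Algebra.adjoin ℂ (Set.range f)) hDA hDker (X k)
  rwa [mkDerivation_X] at h

theorem not_dvd_jac_update (f : Fin n → MvPolynomial (Fin n) ℂ)
    [Algebra.IsIntegral (Algebra.adjoin ℂ (Set.range f)) (MvPolynomial (Fin n) ℂ)]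
    {Q p : MvPolynomial (Fin n) ℂ} (hQ : Irreducible Q) (i : Fin n)
    (hp : Q ∣ aeval f p) (hi : ¬ Q ∣ aeval f (pderiv i p)) :
    ¬ Q ∣ Jac (Function.update f i Q) := by
  have hprime : (Ideal.span {Q}).IsPrime :=
    (Ideal.span_singleton_prime hQ.ne_zero).mpr hQ.prime
  have hker : ∀ y, algebraMap (MvPolynomial (Fin n) ℂ)
      (MvPolynomial (Fin n) ℂ ⧸ Ideal.span {Q}) y = 0 ↔ Q ∣ y := fun y => by
    rw [← Ideal.mem_span_singleton]; exact Ideal.Quotient.eq_zero_iff_mem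
  rw [← hker]
  exact algebraMap_jac_update_ne_zero f hker i hp hi

/-- The order of the Jacobian along `Q` is one less than the ramification index of `Q`. -/
theorem RamIdx.multIs_jac (f : Fin n → MvPolynomial (Fin n) ℂ)
    [Module.Finite (Algebra.adjoin ℂ (Set.range f)) (MvPolynomial (Fin n) ℂ)]
    {Q : MvPolynomial (Fin n) ℂ} (hQ : Irreducible Q) {e : ℕ}
    (h : RamIdx (Algebra.adjoin ℂ (Set.range f)) Q e) :
    0 < e ∧ MultIs Q (Jac f) (e - 1) := by
  obtain ⟨P, hPirr, hPspan, ⟨R, hR⟩, hmult⟩ := h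
  have hind := algebraicIndependent_of_finite_adjoin f
  have hmem : ∀ y : Algebra.adjoin ℂ (Set.range f),
      Q ∣ (y : MvPolynomial (Fin n) ℂ) ↔ P ∣ y := fun y => by
    rw [← Ideal.mem_span_singleton, ← Ideal.mem_span_singleton, ← hPspan]; rfl
  obtain ⟨p, hp⟩ : ∃ p, hind.aevalEquiv p = P := hind.aevalEquiv.surjective P
  have hval : ∀ q, ((hind.aevalEquiv q : Algebra.adjoin ℂ (Set.range f)) :
      MvPolynomial (Fin n) ℂ) = aeval f q := hind.algebraMap_aevalEquiv
  have hdvd : ∀ q, Q ∣ aeval f q ↔ p ∣ q := fun q => by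
    rw [← hval, hmem, ← hp]
    exact map_dvd_iff hind.aevalEquiv
  have hpirr : Irreducible p := by
    rw [← hp] at hPirr
    exact (MulEquiv.irreducible_iff hind.aevalEquiv).mp hPirr
  obtain ⟨i, hi⟩ : ∃ i, pderiv i p ≠ 0 := by
    refine exists_pderiv_ne_zero fun hC => ?_
    rw [hC] at hpirr
    have h0 : coeff 0 p ≠ 0 := fun h0 => hpirr.ne_zero (by rw [h0, map_zero])
    exact hpirr.not_isUnit ((isUnit_iff_ne_zero.mpr h0).map C)
  have hQi : ¬ Q ∣ aeval f (pderiv i p) := fun hd => not_dvd_pderiv hi ((hdvd _).mp hd)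
  have hQp : Q ∣ aeval f p := (hdvd p).mpr dvd_rfl
  have hJQ := not_dvd_jac_update f hQ i hQp hQi
  have hPp : aeval f p = Q ^ e * R := by rw [← hval, hp, hR]
  have hQR : ¬ Q ∣ R := by
    rintro ⟨R', rfl⟩
    exact hmult ⟨R', by rw [hR, pow_succ, mul_assoc]⟩
  obtain ⟨d, rfl⟩ : ∃ d, e = d + 1 := by
    refine Nat.exists_eq_succ_of_ne_zero fun h0 => hQR ?_
    rw [hPp, h0, pow_zero, one_mul] at hQp
    exact hQp
  have key : aeval f (pderiv i p) * Jac f =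
      Q ^ d * (R * (((d + 1 : ℕ) : MvPolynomial (Fin n) ℂ) * Jac (Function.update f i Q)) +
        Q * Jac (Function.update f i R)) := by
    rw [← jac_update_aeval, hPp, jac_update_mul, jac_update_pow, Nat.add_sub_cancel]
    ring
  refine ⟨d.succ_pos, ?_, ?_⟩
  · rw [Nat.add_sub_cancel]
    exact hQ.prime.pow_dvd_of_dvd_mul_left _ hQi (Dvd.intro _ key.symm)
  · rw [Nat.add_sub_cancel]
    intro hd
    have h1 := hd.mul_left (aeval f (pderiv i p))
    rw [key, pow_succ, mul_dvd_mul_iff_left (pow_ne_zero _ hQ.ne_zero),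
      dvd_add_left (dvd_mul_right _ _)] at h1
    rcases hQ.prime.dvd_or_dvd h1 with h2 | h2
    · exact hQR h2
    rcases hQ.prime.dvd_or_dvd h2 with h3 | h3
    · refine hQ.not_isUnit (isUnit_of_dvd_unit h3 ?_)
      rw [← map_natCast (C : ℂ →+* MvPolynomial (Fin n) ℂ)]
      exact (isUnit_iff_ne_zero.mpr (Nat.cast_ne_zero.mpr d.succ_ne_zero)).map C
    · exact hJQ h3

attribute [local instance] FractionRing.liftAlgebra in
/-- The contraction of a principal prime along a finite extension of a factorial domain is
principal. -/
theorem exists_irreducible_comap_eq_span {A B : Type*} [CommRing A] [IsDomain A]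
    [UniqueFactorizationMonoid A] [CommRing B] [IsDomain B] [IsIntegrallyClosed B] [Algebra A B]
    [Module.Finite A B] [Module.IsTorsionFree A B] {Q : B} (hQ : Prime Q) :
    ∃ P : A, Irreducible P ∧ (Ideal.span {Q}).comap (algebraMap A B) = Ideal.span {P} := by
  have : FiniteDimensional (FractionRing A) (FractionRing B) :=
    .of_isLocalization A B (nonZeroDivisors A)
  have : Module.Free (FractionRing A) (FractionRing B) := Module.Free.of_divisionRing _ _
  set N := Algebra.intNorm A B Q
  have hN0 : N ≠ 0 := Algebra.intNorm_ne_zero.mpr hQ.ne_zero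
  have hprime : (Ideal.span {Q}).IsPrime := (Ideal.span_singleton_prime hQ.ne_zero).mpr hQ
  have hNmem : N ∈ (Ideal.span {Q}).comap (algebraMap A B) :=
    Ideal.mem_comap.mpr (Ideal.mem_span_singleton.mpr (Algebra.dvd_algebraMap_intNorm_self A B Q))
  have hpow : ∀ g ∈ (Ideal.span {Q}).comap (algebraMap A B),
      N ∣ g ^ Module.finrank (FractionRing A) (FractionRing B) := fun g hg => by
    have h := map_dvd (Algebra.intNorm A B) (Ideal.mem_span_singleton.mp (Ideal.mem_comap.mp hg))
    convert h using 1
    apply IsFractionRing.injective A (FractionRing A)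
    rw [Algebra.algebraMap_intNorm (L := FractionRing B), ← IsScalarTower.algebraMap_apply,
      IsScalarTower.algebraMap_apply A (FractionRing A) (FractionRing B), Algebra.norm_algebraMap, map_pow]
  obtain ⟨P, hPirr, hPmem, hPN⟩ : ∃ P : A, Irreducible P ∧
      P ∈ (Ideal.span {Q}).comap (algebraMap A B) ∧ P ∣ N := by
    have hq : ((Ideal.span {Q}).comap (algebraMap A B)).IsPrime := Ideal.IsPrime.comap _
    obtain ⟨P, hPmem, hP⟩ := hq.exists_mem_prime_of_ne_bot
      fun h => hN0 (by rwa [h, Ideal.mem_bot] at hNmem)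
    obtain ⟨P', hP', hP'N⟩ := WfDvdMonoid.exists_irreducible_factor
      (fun hu => hq.ne_top (Ideal.eq_top_of_isUnit_mem _ hNmem hu)) hN0
    have hass := hP'.associated_of_dvd hP.irreducible
      (hP'.prime.dvd_of_dvd_pow (hP'N.trans (hpow P hPmem)))
    exact ⟨P, hP.irreducible, hPmem, hass.symm.dvd.trans hP'N⟩
  refine ⟨P, hPirr, le_antisymm (fun g hg => ?_) ?_⟩
  · exact Ideal.mem_span_singleton.mpr (hPirr.prime.dvd_of_dvd_pow (hPN.trans (hpow g hg)))
  · exact (Ideal.span_singleton_le_iff_mem _).mpr hPmem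

theorem exists_ramIdx (f : Fin n → MvPolynomial (Fin n) ℂ)
    [Module.Finite (Algebra.adjoin ℂ (Set.range f)) (MvPolynomial (Fin n) ℂ)]
    {Q : MvPolynomial (Fin n) ℂ} (hQ : Irreducible Q) :
    ∃ e, RamIdx (Algebra.adjoin ℂ (Set.range f)) Q e := by
  have : UniqueFactorizationMonoid (Algebra.adjoin ℂ (Set.range f)) :=
    (algebraicIndependent_of_finite_adjoin f).aevalEquiv.toMulEquiv.uniqueFactorizationMonoid
      inferInstance
  obtain ⟨P, hP, hspan⟩ :=
    exists_irreducible_comap_eq_span (A := Algebra.adjoin ℂ (Set.range f)) hQ.prime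
  have hfm : FiniteMultiplicity Q (P : MvPolynomial (Fin n) ℂ) :=
    FiniteMultiplicity.of_prime_left hQ.prime fun h => hP.ne_zero (Subtype.ext h)
  exact ⟨_, P, hP, hspan, pow_multiplicity_dvd Q _,
    hfm.not_pow_dvd_of_multiplicity_lt (Nat.lt_succ_self _)⟩

end Ramification

open MvPolynomial in
theorem degree_jacobian_formula {n : ℕ} (hn : 0 < n)
    (b : Fin n → ℕ) (hb : ∀ i, 0 < b i) (a : Fin n → ℕ)
    (f : Fin n → MvPolynomial (Fin n) ℂ)
    (hhom : ∀ i, IsWeightedHomogeneous b (f i) (a i))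
    (A : Subalgebra ℂ (MvPolynomial (Fin n) ℂ))
    (hA : A = Algebra.adjoin ℂ (Set.range f))
    (hfin : Module.Finite A (MvPolynomial (Fin n) ℂ))
    (S : Finset (MvPolynomial (Fin n) ℂ)) (eIdx : MvPolynomial (Fin n) ℂ → ℕ)
    (hS : RamReps A S eIdx) :
    ∑ Q ∈ S, ((eIdx Q : ℤ) - 1) * ((weightedTotalDegree b Q : ℕ) : ℤ) =
      ∑ i, (a i : ℤ) - ∑ i, (b i : ℤ) := by
  subst hA
  obtain ⟨hS1, hS2, hS3⟩ := hS
  have hord := fun Q (hQ : Q ∈ S) => RamIdx.multIs_jac f (hS1 Q hQ).1 (hS1 Q hQ).2.1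
  have hJ : Jac f ≠ 0 := by
    have hX : Irreducible (X ⟨0, hn⟩ : MvPolynomial (Fin n) ℂ) := X_prime.irreducible
    obtain ⟨e, he⟩ := exists_ramIdx f hX
    intro h0
    exact (he.multIs_jac f hX).2.2 (h0 ▸ dvd_zero _)
  obtain ⟨H, hH⟩ : ∏ Q ∈ S, Q ^ (eIdx Q - 1) ∣ Jac f := by
    refine Finset.prod_dvd_of_isRelPrime (fun Q hQ Q' hQ' hne => ?_) fun Q hQ => (hord Q hQ).2.1
    refine IsRelPrime.pow ((hS1 Q hQ).1.isRelPrime_iff_not_dvd.mpr fun hd => ?_)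
    exact hS2 Q hQ Q' hQ' hne ((hS1 Q hQ).1.associated_of_dvd (hS1 Q' hQ').1 hd)
  have hH0 : H ≠ 0 := right_ne_zero_of_mul (hH ▸ hJ)
  have hP0 := left_ne_zero_of_mul (hH ▸ hJ)
  have hunit : IsUnit H := by
    by_contra hnu
    obtain ⟨Q, hQ, hQH⟩ := WfDvdMonoid.exists_irreducible_factor hnu hH0
    obtain ⟨e, he⟩ := exists_ramIdx f hQ
    have hm := he.multIs_jac f hQ
    have he1 : 1 < e := by
      by_contra hle
      have h1 : e = 1 := by omega
      rw [h1] at hm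
      exact hm.2.2 (by simpa using hQH.trans (Dvd.intro_left _ hH.symm))
    obtain ⟨Q', ⟨hQ'S, hass⟩, -⟩ := hS3 Q ⟨hQ, e, he, he1⟩
    refine (hord Q' hQ'S).2.2 ?_
    rw [hH, pow_succ]
    exact mul_dvd_mul (Finset.dvd_prod_of_mem (fun Q => Q ^ (eIdx Q - 1)) hQ'S)
      (hass.dvd_iff_dvd_left.mp hQH)
  have hdeg := weightedTotalDegree_jac b a f hhom hJ
  rw [hH, weightedTotalDegree_mul b hP0 hH0, weightedTotalDegree_of_isUnit b hunit, add_zero,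
    weightedTotalDegree_prod_pow b S _ _ fun Q hQ => (hS1 Q hQ).1.ne_zero] at hdeg
  have hdeg' := congrArg (Nat.cast : ℕ → ℤ) hdeg
  push_cast at hdeg'
  rw [← hdeg', add_sub_cancel_left]
  refine Finset.sum_congr rfl fun Q hQ => ?_
  rw [Nat.cast_sub (hord Q hQ).1, Nat.cast_one]
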